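/- Fix p ∈ (0,1). Then E_p(S_n) ≤ ((1+√(1−p))/p)·n + o_p(n) as n → ∞; precisely, limsup_{n→∞} (E_p(S_n) − ((1+√(1−p))/p)·n)/n ≤ 0. -/

import Mathlib

open scoped Classical ENNReal

noncomputable section

namespace Ungarian

variable {L : Type*} [Fintype L]

/-- `y` is covered by `x` with respect to the order relation `le`. -/
def CovRel (le : L → L → Prop) (x y : L) : Prop :=
  le y x ∧ y ≠ x ∧ ∀ z, le y z → le z x → z = y ∨ z = x

/-- The finset of elements covered by `x`. -/
def covFinset (le : L → L → Prop) (x : L) : Finset L :=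
  Finset.univ.filter fun y => CovRel le x y

/-- `m` is a greatest lower bound of `S` with respect to `le`. -/
def IsMeetOf (le : L → L → Prop) (S : Set L) (m : L) : Prop :=
  (∀ s ∈ S, le m s) ∧ ∀ z, (∀ s ∈ S, le z s) → le z m

/-- The meet of `{x} ∪ T`. -/
def meetOf (le : L → L → Prop) (x : L) (T : Finset L) : L :=
  if h : ∃ m, IsMeetOf le (insert x (T : Set L)) m then h.choose else x

/-- One-step transition probabilities of the Ungarian Markov chain with parameter `p`:
from `x`, a random subset `T` of the set of elements covered by `x` is chosen, each element
independently with probability `p`, and the chain moves to the meet of `{x} ∪ T`. -/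
def stepProb (p : ℝ) (le : L → L → Prop) (x y : L) : ℝ≥0∞ :=
  ∑ T ∈ (covFinset le x).powerset,
    if meetOf le x T = y then
      ENNReal.ofReal (p ^ T.card * (1 - p) ^ ((covFinset le x).card - T.card))
    else 0

/-- Distribution after `t` steps started from `x`. -/
def walk (p : ℝ) (le : L → L → Prop) (x : L) : ℕ → L → ℝ≥0∞
  | 0 => fun y => if y = x then 1 else 0
  | t + 1 => fun y => ∑ z : L, walk p le x t z * stepProb p le z y

/-- Probability that the chain started at `x` lies in `S` after `t` steps. -/
def probIn (p : ℝ) (le : L → L → Prop) (x : L) (t : ℕ) (S : Set L) : ℝ≥0∞ :=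
  ∑ y ∈ Finset.univ.filter (· ∈ S), walk p le x t y

/-- Expected number of steps until absorption at `bot`, computed as `∑_t P(X_t ≠ bot)`. -/
def expAbsorb (p : ℝ) (le : L → L → Prop) (x bot : L) : ℝ≥0∞ :=
  ∑' t : ℕ, probIn p le x t {y | y ≠ bot}

end Ungarian

/-- `τ` is covered by `σ` in the right weak order on `S_n`:
`τ = σ ∘ (i i+1)` for a descent `i` of `σ`. -/
def wCov {n : ℕ} (σ τ : Equiv.Perm (Fin n)) : Prop :=
  ∃ i : ℕ, ∃ h : i + 1 < n,
    σ ⟨i + 1, h⟩ < σ ⟨i, Nat.lt_of_succ_lt h⟩ ∧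
    τ = σ * Equiv.swap ⟨i, Nat.lt_of_succ_lt h⟩ ⟨i + 1, h⟩

/-- The right weak order on `S_n`: reflexive-transitive closure of the covering relations. -/
def weakLe {n : ℕ} (τ σ : Equiv.Perm (Fin n)) : Prop :=
  Relation.ReflTransGen (fun a b => wCov a b) σ τ

/-- `E_p(S_n)`: expected number of steps for the Ungarian Markov chain on the weak order of
`S_n` to go from the decreasing permutation to the identity. -/
def EpSn (p : ℝ) (n : ℕ) : ℝ :=
  (Ungarian.expAbsorb p (fun a b : Equiv.Perm (Fin n) => weakLe a b) Fin.revPerm 1).toReal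

/-- The pair of values `u < v` is an inversion of `σ`: `v` stands to the left of `u`. -/
def IsInv {n : ℕ} (σ : Equiv.Perm (Fin n)) (u v : Fin n) : Prop :=
  u < v ∧ σ.symm v < σ.symm u

theorem isInv_mul_swap {n : ℕ} (σ : Equiv.Perm (Fin n)) (i : ℕ) (h : i + 1 < n)
    (hd : σ ⟨i + 1, h⟩ < σ ⟨i, Nat.lt_of_succ_lt h⟩) (u v : Fin n) :
    IsInv (σ * Equiv.swap ⟨i, Nat.lt_of_succ_lt h⟩ ⟨i + 1, h⟩) u v ↔
      IsInv σ u v ∧ ¬(u = σ ⟨i + 1, h⟩ ∧ v = σ ⟨i, Nat.lt_of_succ_lt h⟩) := by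
  obtain ⟨a, rfl⟩ := σ.surjective u
  obtain ⟨b, rfl⟩ := σ.surjective v
  have e : ∀ x : Fin n, (σ * Equiv.swap (⟨i, Nat.lt_of_succ_lt h⟩ : Fin n) ⟨i + 1, h⟩).symm (σ x) =
      Equiv.swap ⟨i, Nat.lt_of_succ_lt h⟩ ⟨i + 1, h⟩ x := by
    intro x
    rw [Equiv.symm_apply_eq]
    simp [Equiv.Perm.mul_apply]
  simp only [IsInv, e, Equiv.symm_apply_apply, EmbeddingLike.apply_eq_iff_eq]
  rw [and_assoc]
  refine and_congr_right fun hab => ?_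
  simp only [Equiv.swap_apply_def, Fin.ext_iff, Fin.lt_def]
  have ne : a ≠ b := fun h => by simp [h] at hab
  have key : ¬ (a = ⟨i, Nat.lt_of_succ_lt h⟩ ∧ b = ⟨i + 1, h⟩) := by
    rintro ⟨rfl, rfl⟩
    exact absurd hab (not_lt.2 hd.le)
  simp only [Fin.ext_iff, ne_eq] at ne key
  split_ifs <;> simp <;> omega

theorem IsInv.of_weakLe {n : ℕ} {τ σ : Equiv.Perm (Fin n)} (h : weakLe τ σ) {u v : Fin n}
    (huv : IsInv τ u v) : IsInv σ u v := by
  induction h with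
  | refl => exact huv
  | tail _ hstep ih =>
    obtain ⟨i, hi, hd, rfl⟩ := hstep
    exact ih ((isInv_mul_swap _ i hi hd u v).1 huv).1

theorem eq_of_forall_lt_succ {n : ℕ} {σ τ : Equiv.Perm (Fin n)}
    (h : ∀ (i : ℕ) (hi : i + 1 < n),
      τ.symm (σ ⟨i, Nat.lt_of_succ_lt hi⟩) < τ.symm (σ ⟨i + 1, hi⟩)) : τ = σ := by
  have hmono : StrictMono (σ.trans τ.symm) := by
    cases n with
    | zero => exact fun a => a.elim0
    | succ n => exact Fin.strictMono_iff_lt_succ.2 fun i => h i (by omega)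
  have h2 : (StrictMono.orderIsoOfSurjective _ hmono (σ.trans τ.symm).surjective) =
      OrderIso.refl _ := Subsingleton.elim _ _
  ext x
  have h3 := congrArg (fun e => e x) h2
  simp only [StrictMono.coe_orderIsoOfSurjective, OrderIso.refl_apply, Equiv.trans_apply,
    Equiv.symm_apply_eq] at h3
  rw [h3]

theorem weakLe_of_isInv {n : ℕ} {τ σ : Equiv.Perm (Fin n)}
    (h : ∀ u v, IsInv τ u v → IsInv σ u v) : weakLe τ σ := by
  induction hc : (Finset.univ.filter fun x : Fin n × Fin n => IsInv σ x.1 x.2).card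
    using Nat.strong_induction_on generalizing σ with
  | _ c ih =>
  by_cases he : τ = σ
  · rw [he]; exact Relation.ReflTransGen.refl
  obtain ⟨i, hi, hlt⟩ : ∃ (i : ℕ) (hi : i + 1 < n),
      ¬ τ.symm (σ ⟨i, Nat.lt_of_succ_lt hi⟩) < τ.symm (σ ⟨i + 1, hi⟩) := by
    by_contra! hcon
    exact he (eq_of_forall_lt_succ hcon)
  have hne : σ ⟨i, Nat.lt_of_succ_lt hi⟩ ≠ σ ⟨i + 1, hi⟩ := by
    simp
  have hlt' : τ.symm (σ ⟨i + 1, hi⟩) < τ.symm (σ ⟨i, Nat.lt_of_succ_lt hi⟩) :=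
    lt_of_le_of_ne (not_lt.1 hlt) fun h => hne (τ.symm.injective h).symm
  have hd : σ ⟨i + 1, hi⟩ < σ ⟨i, Nat.lt_of_succ_lt hi⟩ := by
    refine lt_of_le_of_ne (not_lt.1 fun hlt2 => ?_) hne.symm
    have := (h _ _ ⟨hlt2, hlt'⟩).2
    simp [Fin.lt_def] at this
  refine Relation.ReflTransGen.head (b := σ * Equiv.swap ⟨i, Nat.lt_of_succ_lt hi⟩ ⟨i + 1, hi⟩)
    ⟨i, hi, hd, rfl⟩ ?_
  refine ih _ ?_ (fun u v huv => ?_) rfl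
  · rw [← hc]
    refine Finset.card_lt_card (Finset.ssubset_iff_subset_ne.2 ⟨fun x hx => ?_, fun heq => ?_⟩)
    · simp only [Finset.mem_filter, Finset.mem_univ, true_and, isInv_mul_swap _ i hi hd] at hx ⊢
      exact hx.1
    · have hm : (σ ⟨i + 1, hi⟩, σ ⟨i, Nat.lt_of_succ_lt hi⟩) ∈
          (Finset.univ.filter fun x : Fin n × Fin n => IsInv σ x.1 x.2) := by
        rw [Finset.mem_filter]
        exact ⟨Finset.mem_univ _, hd, by simp⟩
      rw [← heq, Finset.mem_filter, isInv_mul_swap _ i hi hd] at hm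
      exact hm.2.2 ⟨rfl, rfl⟩
  · rw [isInv_mul_swap _ i hi hd]
    refine ⟨h u v huv, ?_⟩
    rintro ⟨rfl, rfl⟩
    exact absurd huv.2 (not_lt.2 hlt'.le)

theorem eq_of_isInv_iff {n : ℕ} {τ σ : Equiv.Perm (Fin n)}
    (h : ∀ u v, IsInv τ u v ↔ IsInv σ u v) : τ = σ := by
  refine eq_of_forall_lt_succ fun i hi => ?_
  have hne : σ ⟨i, Nat.lt_of_succ_lt hi⟩ ≠ σ ⟨i + 1, hi⟩ := by simp
  rcases lt_or_gt_of_ne hne with hlt | hlt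
  · by_contra hcon
    have hcon' := lt_of_le_of_ne (not_lt.1 hcon) fun h => hne (τ.symm.injective h).symm
    have := ((h _ _).1 ⟨hlt, hcon'⟩).2
    simp [Fin.lt_def] at this
  · exact ((h _ _).2 ⟨hlt, by simp [Fin.lt_def]⟩).2

theorem covRel_weakLe_iff {n : ℕ} (σ τ : Equiv.Perm (Fin n)) :
    Ungarian.CovRel (fun a b : Equiv.Perm (Fin n) => weakLe a b) σ τ ↔ wCov σ τ := by
  constructor
  · rintro ⟨hle, hne, hmin⟩
    rcases Relation.ReflTransGen.cases_head hle with h | ⟨c, hc, hcτ⟩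
    · exact absurd h.symm hne
    · rcases hmin c hcτ (Relation.ReflTransGen.single hc) with rfl | rfl
      · exact hc
      · obtain ⟨i, hi, hd, he⟩ := hc
        have := congrArg (fun e : Equiv.Perm (Fin n) => e ⟨i, Nat.lt_of_succ_lt hi⟩) he
        simp at this
  · intro hc
    have hc' := hc
    obtain ⟨i, hi, hd, rfl⟩ := hc
    refine ⟨Relation.ReflTransGen.single hc', fun he => ?_, fun z hz1 hz2 => ?_⟩
    · have := congrArg (fun e : Equiv.Perm (Fin n) => e ⟨i, Nat.lt_of_succ_lt hi⟩) he
      simp at this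
    · by_cases hz : IsInv z (σ ⟨i + 1, hi⟩) (σ ⟨i, Nat.lt_of_succ_lt hi⟩)
      · right
        refine eq_of_isInv_iff fun u v => ⟨fun h => h.of_weakLe hz2, fun h => ?_⟩
        by_cases hp : u = σ ⟨i + 1, hi⟩ ∧ v = σ ⟨i, Nat.lt_of_succ_lt hi⟩
        · rw [hp.1, hp.2]; exact hz
        · exact ((isInv_mul_swap σ i hi hd u v).2 ⟨h, hp⟩).of_weakLe hz1
      · left
        refine eq_of_isInv_iff fun u v => ⟨fun h => ?_, fun h => h.of_weakLe hz1⟩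
        rw [isInv_mul_swap σ i hi hd]
        refine ⟨h.of_weakLe hz2, ?_⟩
        rintro ⟨rfl, rfl⟩
        exact hz h

theorem eq_of_swap_succ_eq {n i j : ℕ} (hi : i + 1 < n) (hj : j + 1 < n)
    (h : Equiv.swap (⟨i, Nat.lt_of_succ_lt hi⟩ : Fin n) ⟨i + 1, hi⟩ =
      Equiv.swap ⟨j, Nat.lt_of_succ_lt hj⟩ ⟨j + 1, hj⟩) : i = j := by
  have h1 := congrArg (fun e : Equiv.Perm (Fin n) => (e ⟨i, Nat.lt_of_succ_lt hi⟩ : ℕ)) h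
  have h2 := congrArg (fun e : Equiv.Perm (Fin n) => (e ⟨i + 1, hi⟩ : ℕ)) h
  simp only [Equiv.swap_apply_left, Equiv.swap_apply_right, Equiv.swap_apply_def,
    Fin.ext_iff] at h1 h2
  split_ifs at h1 h2 <;> simp only at * <;> omega

/-- In the weak order, an element and any set of elements it covers have a meet. -/
theorem exists_isMeetOf {n : ℕ} (σ : Equiv.Perm (Fin n)) (T : Set (Equiv.Perm (Fin n)))
    (hT : ∀ τ ∈ T, wCov σ τ) :
    ∃ m, Ungarian.IsMeetOf (fun a b : Equiv.Perm (Fin n) => weakLe a b) (insert σ T) m := by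
  -- `block` is constant exactly on the maximal runs of positions joined by chosen descents
  let cut : Finset ℕ := (Finset.range n).filter fun i =>
    ¬ ∃ h : i + 1 < n, σ * Equiv.swap ⟨i, Nat.lt_of_succ_lt h⟩ ⟨i + 1, h⟩ ∈ T
  let block : ℕ → ℕ := fun i => (cut.filter (· < i)).card
  have hbm : Monotone block := fun i j hij =>
    Finset.card_le_card (Finset.monotone_filter_right _ fun x _ hx => lt_of_lt_of_le hx hij)
  have hbs : ∀ i j : ℕ, ∀ hj : j < n, i < j → block i = block j → ∀ l, i ≤ l → ∀ hl : l + 1 ≤ j,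
      σ * Equiv.swap ⟨l, by omega⟩ ⟨l + 1, by omega⟩ ∈ T := by
    intro i j hj hij hb l hil hlj
    by_contra hl
    have : l ∈ cut := by
      simp only [cut, Finset.mem_filter, Finset.mem_range]
      exact ⟨by omega, fun ⟨_, h⟩ => hl h⟩
    have hlt : block i < block j := by
      refine Finset.card_lt_card (Finset.ssubset_iff_subset_ne.2
        ⟨Finset.monotone_filter_right _ fun x _ hx => lt_trans hx hij, fun heq => ?_⟩)
      have h2 : l ∈ cut.filter (· < j) := by simp [this]; omega
      rw [← heq] at h2
      simp at h2
      omega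
    omega
  let key : Fin n → ℕ ×ₗ Fin n := fun i => toLex (block i, σ i)
  have hkinj : Function.Injective key := fun i j hij => by
    have := congrArg (fun x => (ofLex x).2) hij
    simpa [key] using this
  have hsm : StrictMono (key ∘ Tuple.sort key) :=
    (Tuple.monotone_sort key).strictMono_of_injective
      (hkinj.comp (Tuple.sort key).injective)
  have hinv : ∀ u v, IsInv (σ * Tuple.sort key) u v ↔
      u < v ∧ block (σ.symm v) < block (σ.symm u) := by
    intro u v
    refine and_congr_right fun huv => ?_
    rw [← hsm.lt_iff_lt]
    have e : ∀ x, (σ * Tuple.sort key).symm x = (Tuple.sort key).symm (σ.symm x) := fun x => rfl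
    simp only [e, Function.comp_apply, Equiv.apply_symm_apply, key, Prod.Lex.toLex_lt_toLex]
    constructor
    · rintro (h | h)
      · exact h
      · exact absurd h.2 (not_lt.2 huv.le)
    · exact Or.inl
  have hle : ∀ u v, IsInv (σ * Tuple.sort key) u v → IsInv σ u v := by
    intro u v h
    rw [hinv] at h
    exact ⟨h.1, by
      by_contra hcon
      exact absurd h.2 (not_lt.2 (hbm (not_lt.1 hcon)))⟩
  refine ⟨σ * Tuple.sort key, ?_, ?_⟩
  · rintro s (rfl | hs)
    · exact weakLe_of_isInv hle
    · obtain ⟨i, hi, hd, rfl⟩ := hT s hs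
      refine weakLe_of_isInv fun u v h => ?_
      rw [isInv_mul_swap σ i hi hd]
      refine ⟨hle u v h, ?_⟩
      rintro ⟨rfl, rfl⟩
      rw [hinv] at h
      have h2 := h.2
      simp only [Equiv.symm_apply_apply] at h2
      have : block (i + 1) ≤ block i := by
        refine Finset.card_le_card fun x hx => ?_
        simp only [Finset.mem_filter] at hx ⊢
        refine ⟨hx.1, ?_⟩
        by_contra hxi
        obtain rfl : x = i := by omega
        simp only [cut, Finset.mem_filter] at hx
        exact hx.1.2 ⟨hi, hs⟩
      omega
  · intro z hz
    refine weakLe_of_isInv fun u v h => ?_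
    have hσ := h.of_weakLe (hz σ (Set.mem_insert _ _))
    rw [hinv]
    refine ⟨h.1, lt_of_le_of_ne (hbm hσ.2.le) fun heq => ?_⟩
    have run := hbs _ _ (σ.symm u).2 hσ.2 heq
    have chain : ∀ d : ℕ, ∀ hd : (σ.symm v : ℕ) + d ≤ σ.symm u, 
        z.symm (σ ⟨(σ.symm v : ℕ) + d, by omega⟩) ≤ z.symm v := by
      intro d
      induction d with
      | zero => intro hd; exact le_of_eq (congrArg z.symm (σ.apply_symm_apply v))
      | succ d ih =>
        intro hd
        refine le_trans ?_ (ih (by omega))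
        have hm := run (σ.symm v + d) (by omega) (by omega)
        obtain ⟨i, hi, hdes, he⟩ := hT _ hm
        have hle2 := hz _ (Set.mem_insert_of_mem _ hm)
        have hlt : σ ⟨(σ.symm v : ℕ) + d + 1, by omega⟩ < σ ⟨(σ.symm v : ℕ) + d, by omega⟩ := by
          have : (σ.symm v : ℕ) + d = i := eq_of_swap_succ_eq (by omega) hi (mul_left_cancel he)
          subst this
          exact hdes
        by_contra hcon
        have h4 : IsInv z _ _ := ⟨hlt, not_le.1 hcon⟩
        have h5 := h4.of_weakLe hle2
        rw [isInv_mul_swap σ _ (by omega) hlt] at h5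
        exact h5.2 ⟨rfl, rfl⟩
    have hlast := chain ((σ.symm u : ℕ) - σ.symm v) (by have := hσ.2; omega)
    have h6 : (⟨(σ.symm v : ℕ) + ((σ.symm u : ℕ) - σ.symm v), by have := hσ.2; omega⟩ : Fin n) =
        σ.symm u := by
      have h7 : (σ.symm v : ℕ) < σ.symm u := hσ.2
      exact Fin.ext (Nat.add_sub_cancel' h7.le)
    rw [h6, Equiv.apply_symm_apply] at hlast
    exact absurd h.2 (not_lt.2 hlast)

/-- Last-passage times with weights `W + 1` on the cells outside `S`; the cell `(i, j)` is
completed at time `lastPassage S W (i + 1) (j + 1)`. -/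
def lastPassage (S : ℕ → ℕ → Prop) (W : ℕ → ℕ → ℕ) : ℕ → ℕ → ℕ
  | 0, _ => 0
  | _ + 1, 0 => 0
  | i + 1, j + 1 =>
    if S i j then 0
    else max (lastPassage S W i (j + 1)) (lastPassage S W (i + 1) j) + W i j + 1
termination_by i j => i + j

/-- `(i, j)` is an addable cell of `S`. -/
def IsAddable (S : ℕ → ℕ → Prop) (i j : ℕ) : Prop :=
  ¬ S i j ∧ (i = 0 ∨ S (i - 1) j) ∧ (j = 0 ∨ S i (j - 1))

theorem one_add_lastPassage_le {S S' : ℕ → ℕ → Prop} {W W' : ℕ → ℕ → ℕ} {M N : ℕ}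
    (hS : ∀ i j, i < M → j < N → S i j → S' i j)
    (hcorner : ∀ i j, i < M → j < N → IsAddable S i j → ¬ S' i j → W' i j = W i j + 1)
    (hother : ∀ i j, i < M → j < N → ¬ IsAddable S i j → W' i j = W i j)
    (i j : ℕ) (hi : i < M) (hj : j < N) (hij : ¬ S i j) :
    1 + lastPassage S' W (i + 1) (j + 1) ≤ lastPassage S W' (i + 1) (j + 1) := by
  induction hd : i + j using Nat.strong_induction_on generalizing i j with
  | _ d ih =>
  have pos : ∀ i j, ¬ S i j → 1 ≤ lastPassage S W' (i + 1) (j + 1) := by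
    intro i j h
    rw [lastPassage, if_neg h]
    omega
  by_cases h' : S' i j
  · rw [lastPassage, if_pos h']
    exact pos i j hij
  have left : lastPassage S' W i (j + 1) = 0 ∧ (i = 0 ∨ S (i - 1) j) ∨
      1 + lastPassage S' W i (j + 1) ≤ lastPassage S W' i (j + 1) ∧ ¬ (i = 0 ∨ S (i - 1) j) := by
    rcases i with _ | i
    · left; simp [lastPassage]
    · by_cases hs : S i j
      · left
        rw [lastPassage, if_pos (hS i j (by omega) hj hs)]
        simp [hs]
      · right
        exact ⟨ih _ (by omega) i j (by omega) hj hs rfl, by simp [hs]⟩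
  have down : lastPassage S' W (i + 1) j = 0 ∧ (j = 0 ∨ S i (j - 1)) ∨
      1 + lastPassage S' W (i + 1) j ≤ lastPassage S W' (i + 1) j ∧ ¬ (j = 0 ∨ S i (j - 1)) := by
    rcases j with _ | j
    · left; simp [lastPassage]
    · by_cases hs : S i j
      · left
        rw [lastPassage, if_pos (hS i j hi (by omega) hs)]
        simp [hs]
      · right
        exact ⟨ih _ (by omega) i j hi (by omega) hs rfl, by simp [hs]⟩
  rw [lastPassage, lastPassage, if_neg h', if_neg hij]
  by_cases hc : IsAddable S i j
  · rw [hcorner i j hi hj hc h']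
    rcases left with left | left
    · rcases down with down | down
      · omega
      · exact absurd hc.2.2 down.2
    · exact absurd hc.2.1 left.2
  · rw [hother i j hi hj hc]
    rcases left with left | left
    · rcases down with down | down
      · exact absurd ⟨hij, left.2, down.2⟩ hc
      · omega
    · omega

/-- Passing one column: `I` is the increment entering from below, `J` the vertical increments on
the left of the column, `w` the weights; the result lists the vertical increments on the right. -/
def columnStep : {N : ℕ} → ℕ → (Fin N → ℕ) → (Fin N → ℕ) → (Fin N → ℕ)
  | 0, _, J, _ => J
  | _ + 1, I, J, w => Fin.cons ((J 0 - I) + w 0)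
      (columnStep ((I - J 0) + w 0) (Fin.tail J) (Fin.tail w))

/-- Passing all columns of a grid. -/
def columnSteps {N : ℕ} : {M : ℕ} → (Fin M → ℕ) → (Fin N → ℕ) → (Fin M → Fin N → ℕ) → (Fin N → ℕ)
  | 0, _, J, _ => J
  | _ + 1, I, J, W => columnSteps (Fin.tail I) (columnStep (I 0) J (W 0)) (Fin.tail W)

/-- The heights `h` are dominated by the partial sums of `J` started from `b`. -/
def DominatedBy : {N : ℕ} → ℕ → (Fin N → ℕ) → (ℕ → ℕ) → Prop
  | 0, b, _, h => h 0 ≤ b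
  | _ + 1, b, J, h => h 0 ≤ b ∧ DominatedBy (b + J 0) (Fin.tail J) fun j => h (j + 1)

theorem DominatedBy.zero_le {N : ℕ} {b : ℕ} {J : Fin N → ℕ} {h : ℕ → ℕ}
    (hd : DominatedBy b J h) : h 0 ≤ b := by
  cases N with
  | zero => exact hd
  | succ N => exact hd.1

theorem DominatedBy.last_le {N : ℕ} {b : ℕ} {J : Fin N → ℕ} {h : ℕ → ℕ}
    (hd : DominatedBy b J h) : h N ≤ b + ∑ j, J j := by
  induction N generalizing b h with
  | zero => simpa [DominatedBy] using hd
  | succ N ih =>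
    have := ih hd.2
    rw [Fin.sum_univ_succ]
    simp only [Fin.tail] at this
    omega

theorem dominatedBy_of_eq_zero {N : ℕ} {b : ℕ} {J : Fin N → ℕ} {h : ℕ → ℕ}
    (hh : ∀ j, h j = 0) : DominatedBy b J h := by
  induction N generalizing b h with
  | zero => simp [DominatedBy, hh]
  | succ N ih => exact ⟨by simp [hh], ih fun j => hh (j + 1)⟩

theorem DominatedBy.columnStep {N : ℕ} {b I : ℕ} {J w : Fin N → ℕ} {h h' : ℕ → ℕ}
    (hd : DominatedBy b J h) (h0 : h' 0 ≤ b + I)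
    (hs : ∀ j : Fin N, h' (j + 1) ≤ max (h (j + 1)) (h' j) + w j) :
    DominatedBy (b + I) (columnStep I J w) h' := by
  induction N generalizing b I h h' with
  | zero => exact h0
  | succ N ih =>
    refine ⟨h0, ?_⟩
    have h1 := hs 0
    have h2 := hd.2.zero_le
    simp only [Fin.val_zero, zero_add] at h1 h2
    have := ih (I := (I - J 0) + w 0) (w := Fin.tail w) hd.2 (h' := fun j => h' (j + 1))
      (by simp only [zero_add]; omega) fun j => by simpa [Fin.tail] using hs j.succ
    simp only [_root_.columnStep, Fin.cons_zero, Fin.tail_cons]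
    convert this using 1
    omega

theorem dominatedBy_columnSteps {M N : ℕ} {b : ℕ} {I : Fin M → ℕ} {J : Fin N → ℕ}
    {W : Fin M → Fin N → ℕ} {h : ℕ → ℕ → ℕ} (hd : DominatedBy b J (h 0)) (h0 : ∀ i, h i 0 = 0)
    (hs : ∀ (i : Fin M) (j : Fin N), h (i + 1) (j + 1) ≤ max (h i (j + 1)) (h (i + 1) j) + W i j) :
    DominatedBy (b + ∑ i, I i) (columnSteps I J W) (h M) := by
  induction M generalizing b J h with
  | zero => simpa [columnSteps] using hd
  | succ M ih =>
    rw [Fin.sum_univ_succ, ← add_assoc]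
    have h1 : DominatedBy (b + I 0) (columnStep (I 0) J (W 0)) (h 1) :=
      hd.columnStep (by simp [h0]) fun j => by simpa using hs 0 j
    exact ih (W := Fin.tail W) (h := fun i => h (i + 1)) h1 (fun i => h0 _)
      fun i j => by simpa [Fin.tail] using hs i.succ j

theorem lastPassage_zero_right (S : ℕ → ℕ → Prop) (W : ℕ → ℕ → ℕ) (i : ℕ) :
    lastPassage S W i 0 = 0 := by
  cases i <;> rw [lastPassage]

theorem lastPassage_le_columnSteps {M N : ℕ} (S : ℕ → ℕ → Prop) (W : ℕ → ℕ → ℕ)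
    (I : Fin M → ℕ) (J : Fin N → ℕ) :
    lastPassage S W M N ≤
      M + N + (∑ i, I i + ∑ j, columnSteps I J (fun (i : Fin M) (j : Fin N) => W i j) j) := by
  have h := (dominatedBy_columnSteps (b := 0) (I := I) (J := J)
    (W := fun (i : Fin M) (j : Fin N) => W i j) (h := fun i j => lastPassage S W i j - (i + j))
    (dominatedBy_of_eq_zero fun j => by simp [lastPassage])
    (fun i => by simp [lastPassage_zero_right])
    (fun i j => by
      rw [lastPassage]
      split_ifs <;> omega)).last_le
  omega

/-- The number of values below `k` among the first `i` positions of `σ`. -/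
def lowCount {n : ℕ} (σ : Equiv.Perm (Fin n)) (k i : ℕ) : ℕ :=
  (Finset.univ.filter fun j : Fin n => (j : ℕ) < i ∧ (σ j : ℕ) < k).card

theorem lowCount_succ {n : ℕ} (σ : Equiv.Perm (Fin n)) (k i : ℕ) (hi : i < n) :
    lowCount σ k (i + 1) = lowCount σ k i + if (σ ⟨i, hi⟩ : ℕ) < k then 1 else 0 := by
  have hsplit : (Finset.univ.filter fun j : Fin n => (j : ℕ) < i + 1 ∧ (σ j : ℕ) < k) =
      (Finset.univ.filter fun j : Fin n => (j : ℕ) < i ∧ (σ j : ℕ) < k) ∪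
        (if (σ ⟨i, hi⟩ : ℕ) < k then {⟨i, hi⟩} else ∅) := by
    ext j
    by_cases hj : j = ⟨i, hi⟩
    · subst hj
      by_cases hk : (σ ⟨i, hi⟩ : ℕ) < k <;> simp [hk]
    · have : (j : ℕ) ≠ i := fun h => hj (Fin.ext h)
      have h2 : (j : ℕ) < i + 1 ↔ (j : ℕ) < i := by omega
      by_cases hk : (σ ⟨i, hi⟩ : ℕ) < k <;> simp only [hk, if_true, if_false, Finset.mem_union,
        Finset.mem_filter, Finset.mem_univ, true_and, h2,
        Finset.mem_singleton, hj, or_false, Finset.notMem_empty]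
  rw [lowCount, hsplit, Finset.card_union_of_disjoint]
  · rw [lowCount]
    split_ifs <;> simp
  · split_ifs <;> simp

theorem lowCount_le_of_wCov {n : ℕ} {σ τ : Equiv.Perm (Fin n)} (h : wCov σ τ) (k i : ℕ) :
    lowCount σ k i ≤ lowCount τ k i := by
  obtain ⟨p, hp, hd, rfl⟩ := h
  rw [lowCount, lowCount]
  by_cases hi : i = p + 1
  · refine Finset.card_le_card fun j hj => ?_
    rw [Finset.mem_filter] at hj ⊢
    simp only [Finset.mem_univ, true_and, Equiv.Perm.mul_apply] at hj ⊢
    refine ⟨hj.1, ?_⟩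
    by_cases hjp : j = ⟨p, Nat.lt_of_succ_lt hp⟩
    · subst hjp
      rw [Equiv.swap_apply_left]
      exact lt_trans hd hj.2
    · rw [Equiv.swap_apply_of_ne_of_ne hjp]
      · exact hj.2
      · rintro rfl
        simp at hj
        omega
  · refine Finset.card_le_card_of_injOn
      (Equiv.swap ⟨p, Nat.lt_of_succ_lt hp⟩ ⟨p + 1, hp⟩) (fun j hj => ?_)
      (Equiv.injective _).injOn
    rw [Finset.mem_coe, Finset.mem_filter] at hj ⊢
    simp only [Finset.mem_univ, true_and, Equiv.Perm.mul_apply] at hj ⊢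
    refine ⟨?_, by simpa using hj.2⟩
    rw [Equiv.swap_apply_def]
    split_ifs with h1 h2
    · subst h1; simp only at hj ⊢; omega
    · subst h2; simp only at hj ⊢; omega
    · exact hj.1

theorem lowCount_le_of_weakLe {n : ℕ} {σ τ : Equiv.Perm (Fin n)} (h : weakLe τ σ) (k i : ℕ) :
    lowCount σ k i ≤ lowCount τ k i := by
  induction h with
  | refl => exact le_rfl
  | tail _ hs ih => exact ih.trans (lowCount_le_of_wCov hs k i)

theorem le_lowCount_add {n : ℕ} (σ : Equiv.Perm (Fin n)) {k i : ℕ} (hk : k ≤ n) (hi : i ≤ n) :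
    i ≤ lowCount σ k i + (n - k) := by
  have h1 : (Finset.univ.filter fun j : Fin n => (j : ℕ) < i).card = i := by
    rw [Fin.card_filter_val_lt]; omega
  have h2 : (Finset.univ.filter fun j : Fin n => (j : ℕ) < k).card = k := by
    rw [Fin.card_filter_val_lt]; omega
  have h3 : (Finset.univ.filter fun j : Fin n => ¬ (σ j : ℕ) < k).card = n - k := by
    have h4 : (Finset.univ.filter fun j : Fin n => ¬ (σ j : ℕ) < k).card =
        (Finset.univ.filter fun j : Fin n => ¬ (j : ℕ) < k).card :=
      Finset.card_bijective σ σ.bijective fun j => by simp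
    have h5 := Finset.card_filter_add_card_filter_not (s := (Finset.univ : Finset (Fin n)))
      (fun j : Fin n => (j : ℕ) < k)
    rw [h2, Finset.card_univ, Fintype.card_fin] at h5
    omega
  rw [← h3]
  nth_rewrite 1 [← h1]
  refine (Finset.card_le_card fun j hj => ?_).trans (Finset.card_union_le _ _)
  simp only [Finset.mem_union, Finset.mem_filter, Finset.mem_univ, true_and] at hj ⊢
  tauto

theorem eq_one_of_lowCount {n : ℕ} {σ : Equiv.Perm (Fin n)}
    (h : ∀ k, 0 < k → k < n → k ≤ lowCount σ k k) : σ = 1 := by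
  have hle : ∀ j : Fin n, σ j ≤ j := by
    intro j
    by_cases hj : (j : ℕ) + 1 < n
    · have h1 := h (j + 1) (by omega) hj
      have h2 : (Finset.univ.filter fun l : Fin n => (l : ℕ) < j + 1).card = j + 1 := by
        rw [Fin.card_filter_val_lt]; omega
      have h3 := Finset.eq_of_subset_of_card_le (Finset.monotone_filter_right Finset.univ
        (p := fun l : Fin n => (l : ℕ) < j + 1 ∧ (σ l : ℕ) < j + 1)
        (q := fun l : Fin n => (l : ℕ) < j + 1) fun l _ hl => hl.1) (by rw [h2]; exact h1)
      have h4 : j ∈ Finset.univ.filter fun l : Fin n => (l : ℕ) < j + 1 := by simp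
      rw [← h3, Finset.mem_filter] at h4
      have := h4.2.2
      rw [Fin.le_def]
      omega
    · have := (σ j).2
      rw [Fin.le_def]
      omega
  have hsum : ∑ j, (σ j : ℕ) = ∑ j : Fin n, (j : ℕ) := Equiv.sum_comp σ fun j : Fin n => (j : ℕ)
  have := (Finset.sum_eq_sum_iff_of_le fun j _ => Fin.le_def.1 (hle j)).1 hsum
  ext j
  simpa using this j (Finset.mem_univ j)

/-- The cells already passed by `σ` when values are only compared with the threshold `k`. -/
def passedCells {n : ℕ} (σ : Equiv.Perm (Fin n)) (k : ℕ) (i j : ℕ) : Prop :=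
  j < lowCount σ k (n - k - i + j)

/-- `σ` with its entries in positions `i - 1` and `i` exchanged. -/
def adjSwap {n : ℕ} (σ : Equiv.Perm (Fin n)) (i : ℕ) : Equiv.Perm (Fin n) :=
  if h : i < n then σ * Equiv.swap ⟨i - 1, by omega⟩ ⟨i, h⟩ else σ

theorem lowCount_of_isAddable {n k : ℕ} {σ : Equiv.Perm (Fin n)} {i j : ℕ} (hk : k < n)
    (hi : i < n - k) (hj : j < k) (h : IsAddable (passedCells σ k) i j) :
    lowCount σ k (n - k - i + j) = j ∧ lowCount σ k (n - k - i + j - 1) = j ∧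
      lowCount σ k (n - k - i + j + 1) = j + 1 := by
  obtain ⟨h1, h2, h3⟩ := h
  obtain ⟨m, hm⟩ : ∃ m, n - k - i + j = m + 1 := ⟨n - k - i + j - 1, by omega⟩
  have e1 := lowCount_succ σ k m (by omega)
  have e2 := lowCount_succ σ k (m + 1) (by omega)
  have h2' : j < lowCount σ k (m + 1 + 1) := by
    rcases h2 with rfl | h2
    · have := le_lowCount_add σ (k := k) (i := m + 1 + 1) hk.le (by omega)
      omega
    · rcases i with _ | i
      · have := le_lowCount_add σ (k := k) (i := m + 1 + 1) hk.le (by omega)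
        omega
      · have : n - k - (i + 1 - 1) + j = m + 1 + 1 := by omega
        rwa [passedCells, this] at h2
  have h3' : j ≤ lowCount σ k m := by
    rcases h3 with rfl | h3
    · exact Nat.zero_le _
    · rcases j with _ | j
      · exact Nat.zero_le _
      · have : n - k - i + (j + 1 - 1) = m := by omega
        rw [passedCells, this] at h3
        omega
  rw [passedCells, hm] at h1
  rw [hm, Nat.add_sub_cancel]
  split_ifs at e1 e2 <;> omega

theorem wCov_adjSwap_of_isAddable {n k : ℕ} {σ : Equiv.Perm (Fin n)} {i j : ℕ} (hk : k < n)
    (hi : i < n - k) (hj : j < k) (h : IsAddable (passedCells σ k) i j) :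
    wCov σ (adjSwap σ (n - k - i + j)) ∧
      j < lowCount (adjSwap σ (n - k - i + j)) k (n - k - i + j) := by
  obtain ⟨h1, h2, h3⟩ := lowCount_of_isAddable hk hi hj h
  obtain ⟨m, hm⟩ : ∃ m, n - k - i + j = m + 1 := ⟨n - k - i + j - 1, by omega⟩
  have hmn : m + 1 < n := by omega
  rw [hm] at h1 h2 h3 ⊢
  have e1 := lowCount_succ σ k m (by omega)
  have e2 := lowCount_succ σ k (m + 1) hmn
  rw [Nat.add_sub_cancel] at h2
  have d1 : ¬ (σ ⟨m, by omega⟩ : ℕ) < k := by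
    intro hlt
    rw [if_pos hlt] at e1
    omega
  have d2 : (σ ⟨m + 1, hmn⟩ : ℕ) < k := by
    by_contra hlt
    rw [if_neg hlt] at e2
    omega
  have hcov : wCov σ (adjSwap σ (m + 1)) :=
    ⟨m, hmn, by rw [Fin.lt_def]; omega, by simp [adjSwap, hmn]⟩
  refine ⟨hcov, ?_⟩
  have f1 := lowCount_le_of_wCov hcov k m
  have f2 := lowCount_succ (adjSwap σ (m + 1)) k m (by omega)
  rw [if_pos (by simpa [adjSwap, hmn] using d2)] at f2
  omega

theorem adjSwap_injective {n i j : ℕ} (σ : Equiv.Perm (Fin n)) (hi0 : 0 < i) (hj0 : 0 < j)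
    (hi : i < n) (hj : j < n) (h : adjSwap σ i = adjSwap σ j) : i = j := by
  obtain ⟨i, rfl⟩ := Nat.exists_eq_succ_of_ne_zero hi0.ne'
  obtain ⟨j, rfl⟩ := Nat.exists_eq_succ_of_ne_zero hj0.ne'
  simp only [adjSwap, hi, hj, dif_pos] at h
  exact congrArg Nat.succ (eq_of_swap_succ_eq hi hj (mul_left_cancel h))

theorem passedCells_of_weakLe {n : ℕ} {σ τ : Equiv.Perm (Fin n)} (h : weakLe τ σ) {k i j : ℕ}
    (hc : passedCells σ k i j) : passedCells τ k i j :=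
  lt_of_lt_of_le hc (lowCount_le_of_weakLe h k _)

theorem isMeetOf_meetOf {n : ℕ} (σ : Equiv.Perm (Fin n)) {T : Finset (Equiv.Perm (Fin n))}
    (hT : T ⊆ Ungarian.covFinset (fun a b : Equiv.Perm (Fin n) => weakLe a b) σ) :
    Ungarian.IsMeetOf (fun a b : Equiv.Perm (Fin n) => weakLe a b) (insert σ (T : Set _))
      (Ungarian.meetOf (fun a b : Equiv.Perm (Fin n) => weakLe a b) σ T) := by
  have hex := exists_isMeetOf σ (T : Set _) fun τ hτ =>
    (covRel_weakLe_iff σ τ).1 (Finset.mem_filter.1 (hT hτ)).2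
  rw [Ungarian.meetOf, dif_pos hex]
  exact hex.choose_spec

theorem tsum_fin_succ_fun {α : Type*} {n : ℕ} (F : (Fin (n + 1) → α) → ℝ≥0∞) :
    ∑' f, F f = ∑' (a : α) (g : Fin n → α), F (Fin.cons a g) := by
  rw [← (Fin.consEquiv fun _ : Fin (n + 1) => α).tsum_eq,
    ← ENNReal.tsum_prod (f := fun a (g : Fin n → α) => F (Fin.cons a g))]
  rfl

theorem tsum_fin_fun_prod {α : Type*} (n : ℕ) (g : α → ℝ≥0∞) :
    ∑' f : Fin n → α, ∏ i, g (f i) = (∑' a, g a) ^ n := by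
  induction n with
  | zero => simp
  | succ n ih =>
    simp only [tsum_fin_succ_fun, Fin.prod_univ_succ, Fin.cons_zero, Fin.cons_succ,
      ENNReal.tsum_mul_left, ih, ENNReal.tsum_mul_right, pow_succ']

/-- Expectation of `f` over independent weights `W c` with `P * Q ^ k` the probability of `k`. -/
def geomExp {ι : Type*} [Fintype ι] (P Q : ℝ≥0∞) (f : (ι → ℕ) → ℝ≥0∞) : ℝ≥0∞ :=
  ∑' W : ι → ℕ, (∏ c, P * Q ^ W c) * f W

theorem geomExp_mono {ι : Type*} [Fintype ι] (P Q : ℝ≥0∞) {f g : (ι → ℕ) → ℝ≥0∞}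
    (h : ∀ W, f W ≤ g W) : geomExp P Q f ≤ geomExp P Q g :=
  ENNReal.tsum_le_tsum fun W => mul_le_mul_right (h W) _

theorem geomExp_const_mul {ι : Type*} [Fintype ι] (P Q c : ℝ≥0∞) (f : (ι → ℕ) → ℝ≥0∞) :
    geomExp P Q (fun W => c * f W) = c * geomExp P Q f := by
  simp only [geomExp, ← ENNReal.tsum_mul_left]
  exact tsum_congr fun W => by ring

theorem geomExp_curry {M N : ℕ} (P Q : ℝ≥0∞) (f : (Fin M × Fin N → ℕ) → ℝ≥0∞) :
    geomExp P Q f = ∑' W : Fin M → Fin N → ℕ,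
      (∏ i, ∏ j, P * Q ^ W i j) * f (Function.uncurry W) := by
  rw [geomExp, ← (Equiv.curry (Fin M) (Fin N) ℕ).symm.tsum_eq]
  simp only [Fintype.prod_prod_type]
  rfl

theorem geomExp_one {M N : ℕ} {P Q : ℝ≥0∞} (hP : P * ∑' k : ℕ, Q ^ k = 1) :
    geomExp P Q (fun _ : Fin M × Fin N → ℕ => 1) = 1 := by
  rw [geomExp_curry]
  simp only [mul_one]
  rw [tsum_fin_fun_prod M fun w : Fin N → ℕ => ∏ j, P * Q ^ w j,
    tsum_fin_fun_prod N fun k : ℕ => P * Q ^ k, ENNReal.tsum_mul_left, hP, one_pow, one_pow]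

/-- Memorylessness of one coordinate. -/
theorem geomExp_coord {ι : Type*} [Fintype ι] {P Q : ℝ≥0∞} (hP : P * ∑' k : ℕ, Q ^ k = 1)
    (f : (ι → ℕ) → ℝ≥0∞) (c : ι) :
    geomExp P Q f = P * geomExp P Q (fun W => f (Function.update W c 0)) +
      Q * geomExp P Q (fun W => f (Function.update W c (W c + 1))) := by
  have split : ∀ g : (ι → ℕ) → ℝ≥0∞, geomExp P Q g =
      ∑' W : {j // j ≠ c} → ℕ, (∏ j, P * Q ^ W j) *
        ∑' k, P * Q ^ k * g ((Equiv.funSplitAt c ℕ).symm (k, W)) := by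
    intro g
    rw [geomExp, ← (Equiv.funSplitAt c ℕ).symm.tsum_eq]
    refine (ENNReal.tsum_prod (f := fun k W =>
      (∏ j, P * Q ^ ((Equiv.funSplitAt c ℕ).symm (k, W)) j) *
        g ((Equiv.funSplitAt c ℕ).symm (k, W)))).trans ?_
    rw [ENNReal.tsum_comm]
    refine tsum_congr fun W => ?_
    rw [← ENNReal.tsum_mul_left]
    refine tsum_congr fun k => ?_
    rw [Fintype.prod_eq_mul_prod_subtype_ne _ c]
    have h2 : ∀ j : {j // j ≠ c}, ((Equiv.funSplitAt c ℕ).symm (k, W)) j = W j := fun j => by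
      simp [Equiv.funSplitAt, Equiv.piSplitAt, j.2]
    have h3 : ((Equiv.funSplitAt c ℕ).symm (k, W)) c = k := by
      simp [Equiv.funSplitAt, Equiv.piSplitAt]
    simp only [h2, h3]
    ring
  have upd : ∀ (k l : ℕ) (W : {j // j ≠ c} → ℕ),
      Function.update ((Equiv.funSplitAt c ℕ).symm (k, W)) c l =
        (Equiv.funSplitAt c ℕ).symm (l, W) := by
    intro k l W
    ext j
    by_cases hj : j = c
    · subst hj; simp [Equiv.funSplitAt, Equiv.piSplitAt]
    · simp [Equiv.funSplitAt, Equiv.piSplitAt, hj]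
  have upd_self : ∀ (k : ℕ) (W : {j // j ≠ c} → ℕ), (Equiv.funSplitAt c ℕ).symm (k, W) c = k := by
    intro k W
    simp [Equiv.funSplitAt, Equiv.piSplitAt]
  simp only [split, upd, upd_self, ← ENNReal.tsum_mul_left (a := P),
    ← ENNReal.tsum_mul_left (a := Q)]
  rw [← ENNReal.tsum_add]
  refine tsum_congr fun W => ?_
  rw [tsum_eq_zero_add' ENNReal.summable, ENNReal.tsum_mul_right, ENNReal.tsum_mul_left (a := P),
    hP, mul_add, one_mul, pow_zero, mul_one]
  congr 1
  · ring
  · rw [← ENNReal.tsum_mul_left, ← ENNReal.tsum_mul_left, ← ENNReal.tsum_mul_left]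
    exact tsum_congr fun k => by ring

/-- Memorylessness of several coordinates, decided by a larger family of independent coins. -/
theorem geomExp_coins {ι α : Type*} [Fintype ι] {P Q : ℝ≥0∞} (hP : P * ∑' k : ℕ, Q ^ k = 1)
    (hPQ : P + Q = 1) (f : (ι → ℕ) → ℝ≥0∞) (C : Finset ι) (v : ι → α) (hv : Set.InjOn v C)
    (V : Finset α) :
    geomExp P Q f = ∑ T ∈ V.powerset, (∏ y ∈ V, if y ∈ T then P else Q) *
      geomExp P Q fun W => f fun c =>
        if c ∈ C ∧ v c ∈ V then if v c ∈ T then 0 else W c + 1 else W c := by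
  induction V using Finset.induction_on with
  | empty => simp
  | insert y V hy ih =>
    rw [Finset.sum_powerset_insert hy, ← Finset.sum_add_distrib, ih]
    refine Finset.sum_congr rfl fun T hT => ?_
    have hyT : y ∉ T := fun h => hy (Finset.mem_powerset.1 hT h)
    have p1 : (∏ z ∈ insert y V, if z ∈ T then P else Q) =
        Q * ∏ z ∈ V, if z ∈ T then P else Q := by
      rw [Finset.prod_insert hy, if_neg hyT]
    have p2 : (∏ z ∈ insert y V, if z ∈ insert y T then P else Q) =
        P * ∏ z ∈ V, if z ∈ T then P else Q := by
      rw [Finset.prod_insert hy, if_pos (Finset.mem_insert_self _ _)]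
      congr 1
      refine Finset.prod_congr rfl fun z hz => ?_
      have : z ≠ y := fun h => hy (h ▸ hz)
      simp [this]
    rw [p1, p2, mul_assoc, mul_assoc, mul_left_comm Q, mul_left_comm P, ← mul_add]
    congr 1
    by_cases hc : ∃ c ∈ C, v c = y
    · obtain ⟨c, hcC, rfl⟩ := hc
      have hne : ∀ d, d ∈ C → d ≠ c → v d ≠ v c := fun d hd hdc h => hdc (hv hd hcC h)
      rw [geomExp_coord hP _ c, add_comm]
      congr 3
      all_goals
        funext W
        congr 1
        funext d
        by_cases hdc : d = c
        · subst hdc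
          simp [hcC, hy, hyT]
        · by_cases hd : d ∈ C
          · simp [hdc, hd, hne d hd hdc]
          · simp [hdc, hd]
    · have hne : ∀ d, d ∈ C → v d ≠ y := fun d hd h => hc ⟨d, hd, h⟩
      have e1 : ∀ d, (d ∈ C ∧ v d ∈ insert y V) ↔ (d ∈ C ∧ v d ∈ V) := fun d =>
        and_congr_right fun hd => by simp [hne d hd]
      have e2 : ∀ (W : ι → ℕ) (d : ι), (if d ∈ C ∧ v d ∈ V then
          if v d ∈ insert y T then 0 else W d + 1 else W d) =
          if d ∈ C ∧ v d ∈ V then if v d ∈ T then 0 else W d + 1 else W d := by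
        intro W d
        by_cases hd : d ∈ C
        · simp [hne d hd]
        · simp [hd]
      simp only [e1, e2]
      rw [← add_mul, add_comm, hPQ, one_mul]

/-- The local Burke property of geometric last-passage percolation. -/
theorem tsum_burke_cell {P Q s r : ℝ≥0∞} (hP : P * ∑' k : ℕ, Q ^ k = 1) (hsr : s * r = Q)
    (f : ℕ → ℕ → ℝ≥0∞) :
    ∑' (I : ℕ) (J : ℕ) (w : ℕ), s ^ I * r ^ J * (P * Q ^ w) * f ((I - J) + w) ((J - I) + w) =
      ∑' (I : ℕ) (J : ℕ), s ^ I * r ^ J * f I J := by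
  have hR : ∀ I J : ℕ, s ^ I * r ^ J * f I J =
      ∑' m : ℕ, s ^ I * r ^ J * (P * Q ^ m) * f I J := by
    intro I J
    rw [ENNReal.tsum_mul_right, ENNReal.tsum_mul_left, ENNReal.tsum_mul_left, hP, mul_one]
  simp only [hR]
  let e : ℕ × ℕ × ℕ → ℕ × ℕ × ℕ := fun x =>
    ((x.1 - x.2.1) + x.2.2, (x.2.1 - x.1) + x.2.2, min x.1 x.2.1)
  have he : Function.Involutive e := by
    rintro ⟨I, J, w⟩
    simp only [e, Prod.mk.injEq]
    omega
  have hsum : ∀ g : ℕ → ℕ → ℕ → ℝ≥0∞,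
      ∑' (I : ℕ) (J : ℕ) (w : ℕ), g I J w = ∑' x : ℕ × ℕ × ℕ, g x.1 x.2.1 x.2.2 := by
    intro g
    rw [ENNReal.tsum_prod (f := fun I (y : ℕ × ℕ) => g I y.1 y.2)]
    exact tsum_congr fun I => (ENNReal.tsum_prod (f := g I)).symm
  rw [hsum, hsum, ← (he.toPerm e).tsum_eq (fun x : ℕ × ℕ × ℕ =>
    s ^ x.1 * r ^ x.2.1 * (P * Q ^ x.2.2) * f x.1 x.2.1)]
  refine tsum_congr ?_
  rintro ⟨I, J, w⟩
  simp only [Function.Involutive.coe_toPerm, e, ← hsr]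
  congr 1
  rcases le_total I J with h | h
  · obtain ⟨d, rfl⟩ := Nat.exists_eq_add_of_le h
    simp only [Nat.sub_eq_zero_of_le h, Nat.add_sub_cancel_left, min_eq_left h]
    ring
  · obtain ⟨d, rfl⟩ := Nat.exists_eq_add_of_le h
    simp only [Nat.sub_eq_zero_of_le h, Nat.add_sub_cancel_left, min_eq_right h]
    ring

theorem tsum_burke_column {P Q s r : ℝ≥0∞} (hP : P * ∑' k : ℕ, Q ^ k = 1) (hsr : s * r = Q)
    {N : ℕ} (f : (Fin N → ℕ) → ℝ≥0∞) :
    ∑' (I : ℕ) (J : Fin N → ℕ) (w : Fin N → ℕ),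
        s ^ I * (∏ j, r ^ J j) * (∏ j, P * Q ^ w j) * f (columnStep I J w) =
      (∑' k : ℕ, s ^ k) * ∑' J : Fin N → ℕ, (∏ j, r ^ J j) * f J := by
  induction N with
  | zero => simp [columnStep, ENNReal.tsum_mul_right]
  | succ N ih =>
    calc _ = ∑' (I : ℕ) (J0 : ℕ) (w0 : ℕ), s ^ I * r ^ J0 * (P * Q ^ w0) *
          ∑' (J : Fin N → ℕ) (w : Fin N → ℕ), (∏ j, r ^ J j) * (∏ j, P * Q ^ w j) *
            f (Fin.cons ((J0 - I) + w0) (columnStep ((I - J0) + w0) J w)) := by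
          refine tsum_congr fun I => ?_
          rw [tsum_fin_succ_fun]
          refine tsum_congr fun J0 => ?_
          simp only [tsum_fin_succ_fun, ← ENNReal.tsum_mul_left]
          rw [ENNReal.tsum_comm]
          refine tsum_congr fun w0 => tsum_congr fun J => tsum_congr fun w => ?_
          simp only [Fin.prod_univ_succ, Fin.cons_zero, Fin.cons_succ, columnStep, Fin.tail_cons]
          ring
      _ = ∑' (I : ℕ) (J0 : ℕ), s ^ I * r ^ J0 *
          ∑' (J : Fin N → ℕ) (w : Fin N → ℕ), (∏ j, r ^ J j) * (∏ j, P * Q ^ w j) *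
            f (Fin.cons J0 (columnStep I J w)) :=
          tsum_burke_cell hP hsr fun I J0 =>
            ∑' (J : Fin N → ℕ) (w : Fin N → ℕ), (∏ j, r ^ J j) * (∏ j, P * Q ^ w j) *
              f (Fin.cons J0 (columnStep I J w))
      _ = ∑' J0 : ℕ, r ^ J0 * ∑' (I : ℕ) (J : Fin N → ℕ) (w : Fin N → ℕ),
            s ^ I * (∏ j, r ^ J j) * (∏ j, P * Q ^ w j) *
              f (Fin.cons J0 (columnStep I J w)) := by
          rw [ENNReal.tsum_comm]
          simp only [← ENNReal.tsum_mul_left]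
          refine tsum_congr fun J0 => tsum_congr fun I => tsum_congr fun J =>
            tsum_congr fun w => ?_
          ring
      _ = ∑' J0 : ℕ, r ^ J0 * ((∑' k : ℕ, s ^ k) * ∑' J : Fin N → ℕ, (∏ j, r ^ J j) *
            f (Fin.cons J0 J)) :=
          tsum_congr fun J0 => by rw [ih fun J => f (Fin.cons J0 J)]
      _ = _ := by
          rw [tsum_fin_succ_fun, ← ENNReal.tsum_mul_left]
          refine tsum_congr fun J0 => ?_
          rw [mul_left_comm]
          congr 1
          rw [← ENNReal.tsum_mul_left]
          refine tsum_congr fun J => ?_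
          simp only [Fin.prod_univ_succ, Fin.cons_zero, Fin.cons_succ]
          ring

theorem tsum_burke_grid {P Q s r : ℝ≥0∞} (hP : P * ∑' k : ℕ, Q ^ k = 1) (hsr : s * r = Q)
    {M N : ℕ} (f : (Fin N → ℕ) → ℝ≥0∞) :
    ∑' (I : Fin M → ℕ) (J : Fin N → ℕ) (W : Fin M → Fin N → ℕ),
        (∏ i, s ^ I i) * (∏ j, r ^ J j) * (∏ i, ∏ j, P * Q ^ W i j) * f (columnSteps I J W) =
      (∑' k : ℕ, s ^ k) ^ M * ∑' J : Fin N → ℕ, (∏ j, r ^ J j) * f J := by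
  induction M with
  | zero => simp [columnSteps]
  | succ M ih =>
    calc _ = ∑' (I : Fin M → ℕ) (W : Fin M → Fin N → ℕ),
          (∏ i, s ^ I i) * (∏ i, ∏ j, P * Q ^ W i j) *
            ∑' (I0 : ℕ) (J : Fin N → ℕ) (w : Fin N → ℕ),
              s ^ I0 * (∏ j, r ^ J j) * (∏ j, P * Q ^ w j) *
                f (columnSteps I (columnStep I0 J w) W) := by
          simp only [tsum_fin_succ_fun (n := M), ← ENNReal.tsum_mul_left]
          rw [ENNReal.tsum_comm]
          refine tsum_congr fun I => ?_
          rw [ENNReal.tsum_comm (β := ℕ)]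
          refine tsum_congr fun I0 => ?_
          rw [ENNReal.tsum_comm (α := Fin M → Fin N → ℕ) (β := Fin N → ℕ)]
          refine tsum_congr fun J => ?_
          rw [ENNReal.tsum_comm (α := Fin M → Fin N → ℕ) (β := Fin N → ℕ)]
          refine tsum_congr fun w => tsum_congr fun W => ?_
          simp only [Fin.prod_univ_succ, Fin.cons_zero, Fin.cons_succ, columnSteps, Fin.tail_cons]
          ring
      _ = ∑' (I : Fin M → ℕ) (W : Fin M → Fin N → ℕ),
          (∏ i, s ^ I i) * (∏ i, ∏ j, P * Q ^ W i j) *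
            ((∑' k : ℕ, s ^ k) * ∑' J : Fin N → ℕ, (∏ j, r ^ J j) * f (columnSteps I J W)) :=
          tsum_congr fun I => tsum_congr fun W => by
            rw [tsum_burke_column hP hsr fun J => f (columnSteps I J W)]
      _ = (∑' k : ℕ, s ^ k) * ∑' (I : Fin M → ℕ) (J : Fin N → ℕ) (W : Fin M → Fin N → ℕ),
          (∏ i, s ^ I i) * (∏ j, r ^ J j) * (∏ i, ∏ j, P * Q ^ W i j) *
            f (columnSteps I J W) := by
          rw [← ENNReal.tsum_mul_left]
          refine tsum_congr fun I => ?_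
          rw [ENNReal.tsum_comm (β := Fin M → Fin N → ℕ)]
          simp only [← ENNReal.tsum_mul_left]
          refine tsum_congr fun W => tsum_congr fun J => ?_
          ring
      _ = _ := by rw [ih, pow_succ']; ring

/-- Extension of a grid of weights by zero. -/
def extendGrid {M N : ℕ} (W : Fin M × Fin N → ℕ) (i j : ℕ) : ℕ :=
  if h : i < M ∧ j < N then W (⟨i, h.1⟩, ⟨j, h.2⟩) else 0

theorem geomExp_lastPassage_le {P Q X a : ℝ≥0∞} (hP : P * ∑' k : ℕ, Q ^ k = 1)
    (hX : 1 ≤ X) (ha : a * X * a = Q) {M N : ℕ} (S : ℕ → ℕ → Prop) :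
    (∑' k : ℕ, a ^ k) ^ (M + N) * geomExp P Q (fun W : Fin M × Fin N → ℕ =>
        X ^ lastPassage S (extendGrid W) M N) ≤
      X ^ (M + N) * (∑' k : ℕ, (a * X) ^ k) ^ (M + N) := by
  have hJ : ∑' J : Fin N → ℕ, (∏ j, a ^ J j) * ∏ j, X ^ J j = (∑' k : ℕ, (a * X) ^ k) ^ N := by
    rw [← tsum_fin_fun_prod]
    refine tsum_congr fun J => ?_
    rw [← Finset.prod_mul_distrib]
    exact Finset.prod_congr rfl fun j _ => (mul_pow _ _ _).symm
  rw [pow_add (∑' k : ℕ, (a * X) ^ k), ← hJ,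
    ← tsum_burke_grid (M := M) hP ha fun J : Fin N → ℕ => ∏ j, X ^ J j, pow_add, mul_assoc,
    ← tsum_fin_fun_prod M fun k : ℕ => a ^ k, ← tsum_fin_fun_prod N fun k : ℕ => a ^ k,
    ← ENNReal.tsum_mul_right, ← ENNReal.tsum_mul_left, geomExp_curry]
  refine ENNReal.tsum_le_tsum fun I => ?_
  rw [← ENNReal.tsum_mul_right, ← ENNReal.tsum_mul_left, ← ENNReal.tsum_mul_left]
  refine ENNReal.tsum_le_tsum fun J => ?_
  rw [← ENNReal.tsum_mul_left, ← ENNReal.tsum_mul_left, ← ENNReal.tsum_mul_left]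
  refine ENNReal.tsum_le_tsum fun W => ?_
  have hW : (fun (i : Fin M) (j : Fin N) => extendGrid (Function.uncurry W) i j) = W := by
    funext i j
    simp [extendGrid]
  have h := lastPassage_le_columnSteps S (extendGrid (Function.uncurry W)) I J
  rw [hW] at h
  calc _ ≤ (∏ i, a ^ I i) * ((∏ j, a ^ J j) * ((∏ i, ∏ j, P * Q ^ W i j) *
        X ^ (M + N + (∑ i, I i + ∑ j, columnSteps I J W j)))) := by
        gcongr
    _ = _ := by
        simp only [pow_add, ← Finset.prod_pow_eq_pow_sum, mul_pow, Finset.prod_mul_distrib]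
        ring
namespace Ungarian

variable {L : Type*} [Fintype L]

theorem sum_stepProb_mul (p : ℝ) (hp0 : 0 ≤ p) (hp1 : p ≤ 1) (le : L → L → Prop) (x : L)
    (Φ : L → ℝ≥0∞) :
    ∑ y, stepProb p le x y * Φ y = ∑ T ∈ (covFinset le x).powerset,
      (∏ y ∈ covFinset le x, if y ∈ T then ENNReal.ofReal p else ENNReal.ofReal (1 - p)) *
        Φ (meetOf le x T) := by
  simp only [stepProb, Finset.sum_mul]
  rw [Finset.sum_comm]
  refine Finset.sum_congr rfl fun T hT => ?_
  rw [Finset.sum_eq_single (meetOf le x T) (fun y _ hy => by rw [if_neg hy.symm, zero_mul])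
    (fun h => absurd (Finset.mem_univ _) h), if_pos rfl]
  congr 1
  have hT' := Finset.mem_powerset.1 hT
  rw [Finset.prod_ite, Finset.prod_const, Finset.prod_const,
    Finset.filter_mem_eq_inter, Finset.inter_eq_right.2 hT', Finset.filter_not,
    Finset.filter_mem_eq_inter, Finset.inter_eq_right.2 hT', Finset.card_sdiff_of_subset hT',
    ENNReal.ofReal_mul (pow_nonneg hp0 _), ENNReal.ofReal_pow hp0,
    ENNReal.ofReal_pow (sub_nonneg.2 hp1)]

theorem sum_walk_mul_le (p : ℝ) (le : L → L → Prop) (Φ : L → ℝ≥0∞) (X : ℝ≥0∞)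
    (h : ∀ x, X * ∑ y, stepProb p le x y * Φ y ≤ Φ x) (x : L) (t : ℕ) :
    X ^ t * ∑ y, walk p le x t y * Φ y ≤ Φ x := by
  induction t with
  | zero => simp [walk]
  | succ t ih =>
    calc X ^ (t + 1) * ∑ y, walk p le x (t + 1) y * Φ y
        = X ^ t * ∑ z, walk p le x t z * (X * ∑ y, stepProb p le z y * Φ y) := by
          simp only [walk, Finset.sum_mul, Finset.mul_sum]
          rw [Finset.sum_comm]
          refine Finset.sum_congr rfl fun z _ => Finset.sum_congr rfl fun y _ => ?_
          ring
      _ ≤ X ^ t * ∑ z, walk p le x t z * Φ z := by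
          gcongr with z
          exact h z
      _ ≤ Φ x := ih

theorem probIn_le_sum (p : ℝ) (le : L → L → Prop) (x : L) (t : ℕ) {S : Set L} {Φ : L → ℝ≥0∞}
    (h : ∀ y ∈ S, 1 ≤ Φ y) : probIn p le x t S ≤ ∑ y, walk p le x t y * Φ y :=
  le_trans (Finset.sum_le_sum fun y hy => le_mul_of_one_le_right' (h y (Finset.mem_filter.1 hy).2))
    (Finset.sum_le_sum_of_subset (Finset.filter_subset _ _))

theorem probIn_le_one (p : ℝ) (hp0 : 0 ≤ p) (hp1 : p ≤ 1) (le : L → L → Prop) (x : L) (t : ℕ)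
    (S : Set L) : probIn p le x t S ≤ 1 := by
  have h := sum_walk_mul_le p le (fun _ => 1) 1 (fun x => by
    rw [sum_stepProb_mul p hp0 hp1, one_mul]
    simp only [mul_one]
    refine le_of_eq ?_
    have h2 := Finset.prod_add (fun _ : L => ENNReal.ofReal p) (fun _ => ENNReal.ofReal (1 - p))
      (covFinset le x)
    rw [← ENNReal.ofReal_add hp0 (sub_nonneg.2 hp1), add_sub_cancel, ENNReal.ofReal_one,
      Finset.prod_const_one] at h2
    rw [h2]
    refine Finset.sum_congr rfl fun T hT => ?_
    have hT' := Finset.mem_powerset.1 hT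
    rw [Finset.prod_ite, Finset.filter_mem_eq_inter, Finset.inter_eq_right.2 hT',
      Finset.filter_not, Finset.filter_mem_eq_inter, Finset.inter_eq_right.2 hT']) x t
  simp only [one_pow, one_mul, mul_one] at h
  exact (Finset.sum_le_sum_of_subset (Finset.filter_subset _ _)).trans h

end Ungarian

/-- Exponential moment of the last-passage time of the cells not yet passed by `σ`, restricted
to the event that the threshold `k` is not sorted yet. -/
def sortPotential {n : ℕ} (P Q X : ℝ≥0∞) (k : ℕ) (σ : Equiv.Perm (Fin n)) : ℝ≥0∞ :=
  geomExp P Q fun W : Fin (n - k) × Fin k → ℕ =>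
    if lastPassage (passedCells σ k) (extendGrid W) (n - k) k = 0 then 0
    else X ^ lastPassage (passedCells σ k) (extendGrid W) (n - k) k

theorem sortPotential_step {n k : ℕ} (p : ℝ) (hp0 : 0 < p) (hp1 : p ≤ 1) {X : ℝ≥0∞}
    (hX : 1 ≤ X) (hP : ENNReal.ofReal p * ∑' k : ℕ, ENNReal.ofReal (1 - p) ^ k = 1)
    (hk0 : 0 < k) (hkn : k < n) (σ : Equiv.Perm (Fin n)) :
    X * ∑ y, Ungarian.stepProb p (fun a b : Equiv.Perm (Fin n) => weakLe a b) σ y *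
        sortPotential (ENNReal.ofReal p) (ENNReal.ofReal (1 - p)) X k y ≤
      sortPotential (ENNReal.ofReal p) (ENNReal.ofReal (1 - p)) X k σ := by
  obtain ⟨N, rfl⟩ := Nat.exists_eq_succ_of_ne_zero hk0.ne'
  obtain ⟨M, hM⟩ : ∃ M, n - (N + 1) = M + 1 := ⟨n - (N + 1) - 1, by omega⟩
  have hmeet : ∀ T ∈ (Ungarian.covFinset (fun a b : Equiv.Perm (Fin n) => weakLe a b) σ).powerset,
      _ := fun T hT => isMeetOf_meetOf σ (Finset.mem_powerset.1 hT)
  rw [Ungarian.sum_stepProb_mul p hp0.le hp1, Finset.mul_sum]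
  simp only [Nat.succ_eq_add_one] at *
  by_cases hdone : passedCells σ (N + 1) M N
  · refine le_of_eq_of_le (Finset.sum_eq_zero fun T hT => ?_) zero_le
    have h1 : passedCells (Ungarian.meetOf (fun a b : Equiv.Perm (Fin n) => weakLe a b) σ T)
        (N + 1) M N := passedCells_of_weakLe ((hmeet T hT).1 σ (Set.mem_insert _ _)) hdone
    have h2 : sortPotential (ENNReal.ofReal p) (ENNReal.ofReal (1 - p)) X (N + 1)
        (Ungarian.meetOf (fun a b : Equiv.Perm (Fin n) => weakLe a b) σ T) = 0 := by
      rw [sortPotential, hM]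
      have h3 : ∀ W, lastPassage (passedCells (Ungarian.meetOf
          (fun a b : Equiv.Perm (Fin n) => weakLe a b) σ T) (N + 1)) W (M + 1) (N + 1) = 0 :=
        fun W => by rw [lastPassage, if_pos h1]
      simp [h3, geomExp]
    rw [h2, mul_zero, mul_zero]
  · let C : Finset (Fin (n - (N + 1)) × Fin (N + 1)) :=
      Finset.univ.filter fun c => IsAddable (passedCells σ (N + 1)) c.1 c.2
    let v : Fin (n - (N + 1)) × Fin (N + 1) → Equiv.Perm (Fin n) :=
      fun c => adjSwap σ (n - (N + 1) - c.1 + c.2)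
    have hC : ∀ c, c ∈ C ↔ IsAddable (passedCells σ (N + 1)) c.1 c.2 := fun c => by simp [C]
    have hvC : ∀ c ∈ C, wCov σ (v c) ∧
        (c.2 : ℕ) < lowCount (v c) (N + 1) (n - (N + 1) - c.1 + c.2) := fun c hc =>
      wCov_adjSwap_of_isAddable hkn c.1.2 c.2.2 ((hC c).1 hc)
    have hinj : Set.InjOn v C := by
      intro c hc d hd hcd
      have hc1 := c.1.2
      have hc2 := c.2.2
      have hd1 := d.1.2
      have hd2 := d.2.2
      have he := adjSwap_injective σ (by omega) (by omega) (by omega) (by omega) hcd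
      have hlc := (lowCount_of_isAddable hkn hc1 hc2 ((hC c).1 hc)).1
      have hld := (lowCount_of_isAddable hkn hd1 hd2 ((hC d).1 hd)).1
      rw [he] at hlc
      have h2 : (c.2 : ℕ) = d.2 := by omega
      exact Prod.ext (Fin.ext (by omega)) (Fin.ext h2)
    have hmem : ∀ c ∈ C,
        v c ∈ Ungarian.covFinset (fun a b : Equiv.Perm (Fin n) => weakLe a b) σ := fun c hc =>
      Finset.mem_filter.2 ⟨Finset.mem_univ _, (covRel_weakLe_iff _ _).2 (hvC c hc).1⟩
    rw [sortPotential, geomExp_coins hP (by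
      rw [← ENNReal.ofReal_add hp0.le (sub_nonneg.2 hp1), add_sub_cancel, ENNReal.ofReal_one])
      _ C v hinj (Ungarian.covFinset (fun a b : Equiv.Perm (Fin n) => weakLe a b) σ)]
    refine Finset.sum_le_sum fun T hT => ?_
    rw [mul_left_comm]
    gcongr
    rw [sortPotential, ← geomExp_const_mul]
    refine geomExp_mono _ _ fun W => ?_
    set m := Ungarian.meetOf (fun a b : Equiv.Perm (Fin n) => weakLe a b) σ T with hm
    set W' : Fin (n - (N + 1)) × Fin (N + 1) → ℕ := fun c =>
      if c ∈ C ∧ v c ∈ Ungarian.covFinset (fun a b : Equiv.Perm (Fin n) => weakLe a b) σ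
      then if v c ∈ T then 0 else W c + 1 else W c with hW'
    have key : 1 + lastPassage (passedCells m (N + 1)) (extendGrid W) (M + 1) (N + 1) ≤
        lastPassage (passedCells σ (N + 1)) (extendGrid W') (M + 1) (N + 1) := by
      refine one_add_lastPassage_le (M := n - (N + 1)) (N := N + 1)
        (fun i j _ _ h => passedCells_of_weakLe ((hmeet T hT).1 σ (Set.mem_insert _ _)) h)
        (fun i j hi hj hadd hnot => ?_) (fun i j hi hj hadd => ?_) M N (by omega) (by omega) hdone
      · have hcC : ((⟨i, hi⟩, ⟨j, hj⟩) : Fin (n - (N + 1)) × Fin (N + 1)) ∈ C := (hC _).2 hadd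
        have hnT : v (⟨i, hi⟩, ⟨j, hj⟩) ∉ T := fun hin => hnot
          (lt_of_lt_of_le (hvC _ hcC).2
            (lowCount_le_of_weakLe ((hmeet T hT).1 _ (Set.mem_insert_of_mem _ hin)) _ _))
        simp [extendGrid, hi, hj, hW', hcC, hmem _ hcC, hnT]
      · have hcC : ((⟨i, hi⟩, ⟨j, hj⟩) : Fin (n - (N + 1)) × Fin (N + 1)) ∉ C :=
          fun h => hadd ((hC _).1 h)
        simp [extendGrid, hi, hj, hW', hcC]
    rw [← hM] at key
    suffices h : X *
        (if lastPassage (passedCells m (N + 1)) (extendGrid W) (n - (N + 1)) (N + 1) = 0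
        then 0 else X ^ lastPassage (passedCells m (N + 1)) (extendGrid W) (n - (N + 1)) (N + 1)) ≤
        if lastPassage (passedCells σ (N + 1)) (extendGrid W') (n - (N + 1)) (N + 1) = 0
        then 0 else X ^ lastPassage (passedCells σ (N + 1)) (extendGrid W') (n - (N + 1)) (N + 1) by
      convert h
    rw [if_neg (by omega : ¬ lastPassage (passedCells σ (N + 1)) (extendGrid W')
      (n - (N + 1)) (N + 1) = 0)]
    split_ifs with h0
    · simp
    · rw [← pow_succ']
      exact pow_le_pow_right₀ hX (by omega)

theorem one_le_sum_sortPotential {n : ℕ} {P Q X : ℝ≥0∞} (hX : 1 ≤ X)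
    (hP : P * ∑' k : ℕ, Q ^ k = 1) {σ : Equiv.Perm (Fin n)} (hσ : σ ≠ 1) :
    1 ≤ ∑ k ∈ Finset.Ico 1 n, sortPotential P Q X k σ := by
  obtain ⟨k, hk0, hkn, hk⟩ : ∃ k, 0 < k ∧ k < n ∧ lowCount σ k k < k := by
    by_contra! h
    exact hσ (eq_one_of_lowCount h)
  refine le_trans ?_ (Finset.single_le_sum (f := fun k => sortPotential P Q X k σ)
    (fun _ _ => zero_le) (Finset.mem_Ico.2 ⟨hk0, hkn⟩))
  rw [← geomExp_one (M := n - k) (N := k) hP]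
  refine geomExp_mono _ _ fun W => ?_
  have hpos : lastPassage (passedCells σ k) (extendGrid W) (n - k) k ≠ 0 := by
    obtain ⟨N, rfl⟩ := Nat.exists_eq_succ_of_ne_zero hk0.ne'
    obtain ⟨M, hM⟩ : ∃ M, n - (N + 1) = M + 1 := ⟨n - (N + 1) - 1, by omega⟩
    have hnot : ¬ passedCells σ (N + 1) M N := by
      rw [passedCells, show n - (N + 1) - M + N = N + 1 by omega]
      simp only [Nat.succ_eq_add_one] at hk
      omega
    have h : ∀ W', lastPassage (passedCells σ (N + 1)) W' (M + 1) (N + 1) ≠ 0 := fun W' => by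
      rw [lastPassage, if_neg hnot]
      omega
    rw [← hM] at h
    exact h (extendGrid W)
  rw [if_neg hpos]
  exact one_le_pow₀ hX

theorem sortPotential_le {n k : ℕ} {P Q X a : ℝ≥0∞} (hP : P * ∑' k : ℕ, Q ^ k = 1)
    (hX : 1 ≤ X) (ha : a * X * a = Q) (hk : k ≤ n) (σ : Equiv.Perm (Fin n)) :
    (∑' k : ℕ, a ^ k) ^ n * sortPotential P Q X k σ ≤
      X ^ n * (∑' k : ℕ, (a * X) ^ k) ^ n := by
  have h := geomExp_lastPassage_le hP hX ha (M := n - k) (N := k) (passedCells σ k)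
  rw [Nat.sub_add_cancel hk] at h
  refine le_trans (mul_le_mul_right (geomExp_mono _ _ fun W => ?_) _) h
  split_ifs
  · exact zero_le
  · exact le_rfl

/-- The exponential rate attached to the parameter `x`. -/
def rate (p x : ℝ) : ℝ :=
  x * (1 - √((1 - p) / x)) / (1 - √((1 - p) / x) * x)

theorem tsum_ofReal_geometric {a : ℝ} (h0 : 0 ≤ a) (h1 : a < 1) :
    ∑' k : ℕ, ENNReal.ofReal a ^ k = ENNReal.ofReal (1 - a)⁻¹ := by
  rw [ENNReal.tsum_geometric, ENNReal.ofReal_inv_of_pos (by linarith),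
    ENNReal.ofReal_sub _ h0, ENNReal.ofReal_one]

theorem probIn_le_rate {p x : ℝ} (hp0 : 0 < p) (hp1 : p < 1) (hx : 1 < x)
    (hs : √((1 - p) / x) * x < 1) (n t : ℕ) :
    Ungarian.probIn p (fun a b : Equiv.Perm (Fin n) => weakLe a b) Fin.revPerm t {y | y ≠ 1} ≤
      ENNReal.ofReal (n * rate p x ^ n * (x⁻¹) ^ t) := by
  set a := √((1 - p) / x) with ha
  have hx0 : 0 < x := by linarith
  have ha0 : 0 ≤ a := Real.sqrt_nonneg _
  have ha1 : a < 1 := by nlinarith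
  have haa : a * x * a = 1 - p := by
    have : a * a = (1 - p) / x := Real.mul_self_sqrt (div_nonneg (by linarith) hx0.le)
    rw [mul_right_comm, this, div_mul_cancel₀ _ hx0.ne']
  have hP : ENNReal.ofReal p * ∑' k : ℕ, ENNReal.ofReal (1 - p) ^ k = 1 := by
    rw [tsum_ofReal_geometric (by linarith) (by linarith), ← ENNReal.ofReal_mul hp0.le,
      sub_sub_cancel, mul_inv_cancel₀ hp0.ne', ENNReal.ofReal_one]
  have hX : 1 ≤ ENNReal.ofReal x := ENNReal.one_le_ofReal.2 hx.le
  have haX : ENNReal.ofReal a * ENNReal.ofReal x * ENNReal.ofReal a = ENNReal.ofReal (1 - p) := by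
    rw [← ENNReal.ofReal_mul ha0, ← ENNReal.ofReal_mul (by positivity), haa]
  have hrate : 0 ≤ rate p x :=
    div_nonneg (mul_nonneg hx0.le (sub_nonneg.2 ha1.le)) (sub_nonneg.2 hs.le)
  have hpot : ∀ k ≤ n, sortPotential (ENNReal.ofReal p) (ENNReal.ofReal (1 - p))
      (ENNReal.ofReal x) k (Fin.revPerm : Equiv.Perm (Fin n)) ≤ ENNReal.ofReal (rate p x ^ n) := by
    intro k hk
    have h := sortPotential_le hP hX haX hk (Fin.revPerm : Equiv.Perm (Fin n))
    rw [← ENNReal.ofReal_mul ha0, tsum_ofReal_geometric ha0 ha1,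
      tsum_ofReal_geometric (by positivity) hs] at h
    have h1a : 0 < 1 - a := by linarith
    have h1s : 0 < 1 - a * x := by linarith
    have h2 := mul_le_mul_right h (ENNReal.ofReal (1 - a) ^ n)
    rw [← mul_assoc, ← mul_pow, ← ENNReal.ofReal_mul h1a.le, mul_inv_cancel₀ h1a.ne',
      ENNReal.ofReal_one, one_pow, one_mul, ← mul_pow, ← mul_pow, ← ENNReal.ofReal_mul hx0.le,
      ← ENNReal.ofReal_mul h1a.le] at h2
    refine h2.trans (le_of_eq ?_)
    rw [ENNReal.ofReal_pow hrate, rate]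
    congr 2
    rw [← ha]
    ring
  have hwalk : ENNReal.ofReal x ^ t *
      Ungarian.probIn p (fun a b : Equiv.Perm (Fin n) => weakLe a b) Fin.revPerm t {y | y ≠ 1} ≤
        n * ENNReal.ofReal (rate p x ^ n) := by
    calc _ ≤ ENNReal.ofReal x ^ t * ∑ y, Ungarian.walk p
            (fun a b : Equiv.Perm (Fin n) => weakLe a b) Fin.revPerm t y *
            ∑ k ∈ Finset.Ico 1 n, sortPotential (ENNReal.ofReal p) (ENNReal.ofReal (1 - p))
              (ENNReal.ofReal x) k y := by
          gcongr
          exact Ungarian.probIn_le_sum _ _ _ _ fun y hy => one_le_sum_sortPotential hX hP hy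
      _ = ∑ k ∈ Finset.Ico 1 n, ENNReal.ofReal x ^ t * ∑ y, Ungarian.walk p
            (fun a b : Equiv.Perm (Fin n) => weakLe a b) Fin.revPerm t y *
            sortPotential (ENNReal.ofReal p) (ENNReal.ofReal (1 - p)) (ENNReal.ofReal x) k y := by
          simp only [Finset.mul_sum]
          rw [Finset.sum_comm]
      _ ≤ ∑ _k ∈ Finset.Ico 1 n, ENNReal.ofReal (rate p x ^ n) := by
          refine Finset.sum_le_sum fun k hk => ?_
          rw [Finset.mem_Ico] at hk
          exact (Ungarian.sum_walk_mul_le p _ _ _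
            (sortPotential_step p hp0 hp1.le hX hP hk.1 hk.2) _ t).trans (hpot k hk.2.le)
      _ ≤ _ := by
          rw [Finset.sum_const, nsmul_eq_mul, Nat.card_Ico]
          gcongr
          exact Nat.sub_le _ _
  have h3 := mul_le_mul_right hwalk (ENNReal.ofReal ((x⁻¹) ^ t))
  rw [← mul_assoc, ← ENNReal.ofReal_pow hx0.le, ← ENNReal.ofReal_mul (by positivity), ← mul_pow,
    inv_mul_cancel₀ hx0.ne', one_pow, ENNReal.ofReal_one, one_mul, ← ENNReal.ofReal_natCast,
    ← ENNReal.ofReal_mul (by positivity), ← ENNReal.ofReal_mul (by positivity)] at h3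
  rwa [mul_comm ((x⁻¹) ^ t)] at h3

theorem EpSn_le {p x : ℝ} (hp0 : 0 < p) (hp1 : p < 1) (hx : 1 < x)
    (hs : √((1 - p) / x) * x < 1) (hrate : 0 ≤ rate p x) (n t : ℕ) :
    EpSn p n ≤ t + n * rate p x ^ n * (x⁻¹) ^ t * (1 - x⁻¹)⁻¹ := by
  have hx0 : 0 < x := by linarith
  have hx1 : x⁻¹ < 1 := inv_lt_one_of_one_lt₀ hx
  refine ENNReal.toReal_le_of_le_ofReal (by
    have : 0 ≤ (1 - x⁻¹)⁻¹ := inv_nonneg.2 (by linarith)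
    positivity) ?_
  rw [Ungarian.expAbsorb, ← ENNReal.summable.sum_add_tsum_nat_add' (k := t),
    ENNReal.ofReal_add (by positivity) (by
      have : 0 ≤ (1 - x⁻¹)⁻¹ := inv_nonneg.2 (by linarith)
      positivity)]
  refine add_le_add ?_ ?_
  · refine (Finset.sum_le_sum fun i _ => Ungarian.probIn_le_one p hp0.le hp1.le _ _ i _).trans ?_
    simp
  · refine (ENNReal.tsum_le_tsum fun i => probIn_le_rate hp0 hp1 hx hs n (i + t)).trans ?_
    rw [ENNReal.ofReal_mul (by positivity), ← tsum_ofReal_geometric (by positivity) hx1,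
      ← ENNReal.tsum_mul_left]
    refine ENNReal.tsum_le_tsum fun i => le_of_eq ?_
    rw [← ENNReal.ofReal_pow (by positivity), ← ENNReal.ofReal_mul (by positivity), pow_add]
    congr 1
    ring

theorem exists_rate_bound {s c : ℝ} (hs1 : s < 1) (hc : 1 / (1 - s) < c) :
    ∃ y : ℝ, 1 < y ∧ s * y < 1 ∧ Real.log (y * (y - s) / (1 - s * y)) < 2 * c * Real.log y := by
  have h1s : 0 < 1 - s := by linarith
  let φ : ℝ → ℝ := fun y =>
    2 * c * Real.log y - (Real.log y + Real.log (y - s) - Real.log (1 - s * y))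
  have hφ : HasDerivAt φ (2 * c * 1⁻¹ - (1⁻¹ + 1 / (1 - s) - -(s * 1) / (1 - s * 1))) 1 := by
    have h1 : HasDerivAt Real.log (1 : ℝ)⁻¹ 1 := Real.hasDerivAt_log one_ne_zero
    have h2 : HasDerivAt (fun y : ℝ => Real.log (y - s)) (1 / (1 - s)) 1 :=
      ((hasDerivAt_id (1 : ℝ)).sub_const s).log h1s.ne'
    have h3 : HasDerivAt (fun y : ℝ => Real.log (1 - s * y)) (-(s * 1) / (1 - s * 1)) 1 :=
      (((hasDerivAt_id (1 : ℝ)).const_mul s).const_sub 1).log (by simpa using h1s.ne')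
    exact (h1.const_mul _).sub ((h1.add h2).sub h3)
  have hpos : 0 < 2 * c * 1⁻¹ - (1⁻¹ + 1 / (1 - s) - -(s * 1) / (1 - s * 1)) := by
    have : 2 * c * 1⁻¹ - (1⁻¹ + 1 / (1 - s) - -(s * 1) / (1 - s * 1)) =
        2 * (c - 1 / (1 - s)) := by
      field_simp
      ring
    rw [this]
    linarith
  have hslope := (hasDerivAt_iff_tendsto_slope.1 hφ).eventually (lt_mem_nhds hpos)
  have hright : ∀ᶠ y in nhdsWithin (1 : ℝ) (Set.Ioi 1), 0 < slope φ 1 y :=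
    hslope.filter_mono (nhdsWithin_mono _ fun y hy => ne_of_gt hy)
  have hlt : ∀ᶠ y in nhdsWithin (1 : ℝ) (Set.Ioi 1), s * y < 1 :=
    Filter.Eventually.filter_mono nhdsWithin_le_nhds
      ((continuous_const.mul continuous_id).continuousAt.eventually_lt continuousAt_const
        (by simpa using hs1))
  obtain ⟨y, ⟨hy, hsy⟩, hy1⟩ := ((hright.and hlt).and self_mem_nhdsWithin).exists
  have hy1 : 1 < y := hy1
  refine ⟨y, hy1, hsy, ?_⟩
  have hφ1 : φ 1 = 0 := by simp [φ]
  rw [slope_def_field, hφ1, sub_zero] at hy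
  have hφy : 0 < φ y := (div_pos_iff_of_pos_right (sub_pos.2 hy1)).1 hy
  have hy0 : y ≠ 0 := by positivity
  have hys : y - s ≠ 0 := by linarith
  rw [Real.log_div (mul_ne_zero hy0 hys) (by linarith), Real.log_mul hy0 hys]
  simp only [φ] at hφy
  linarith

theorem eventually_EpSn_div_le {p ε : ℝ} (hp0 : 0 < p) (hp1 : p < 1) (hε : 0 < ε) :
    ∀ᶠ n : ℕ in Filter.atTop, (EpSn p n - ((1 + √(1 - p)) / p) * n) / n ≤ ε := by
  set s := √(1 - p) with hs
  have hs0 : 0 ≤ s := Real.sqrt_nonneg _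
  have hss : s * s = 1 - p := Real.mul_self_sqrt (by linarith)
  have hs1 : s < 1 := by nlinarith
  have hc : (1 + s) / p = 1 / (1 - s) := by
    rw [div_eq_div_iff hp0.ne' (by linarith)]
    linarith
  set c := (1 + s) / p with hcdef
  obtain ⟨y, hy1, hsy, hlog⟩ := exists_rate_bound (c := c + ε / 3) hs1 (by linarith)
  have hy0 : 0 < y := by linarith
  have hx1 : 1 < y ^ 2 := one_lt_pow₀ hy1 two_ne_zero
  have hsqrt : √((1 - p) / y ^ 2) = s / y := by
    rw [Real.sqrt_div (by linarith), Real.sqrt_sq hy0.le]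
  have hsx : √((1 - p) / y ^ 2) * y ^ 2 = s * y := by
    rw [hsqrt]
    field_simp
  have hrate : rate p (y ^ 2) = y * (y - s) / (1 - s * y) := by
    rw [rate, hsx, hsqrt]
    congr 1
    field_simp
  have hr0 : 0 < rate p (y ^ 2) := by
    rw [hrate]
    exact div_pos (mul_pos hy0 (by linarith)) (by linarith)
  rw [← hrate] at hlog
  have hlogx : Real.log (y ^ 2) = 2 * Real.log y := by simp
  set x := y ^ 2 with hx
  have hx0 : 0 < x := by linarith
  have hl : 0 < Real.log x := Real.log_pos hx1
  set K := (1 - x⁻¹)⁻¹ with hK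
  have hK0 : 0 < K := inv_pos.2 (sub_pos.2 (inv_lt_one_of_one_lt₀ hx1))
  set q := Real.exp (-(ε / 3 * Real.log x)) with hq
  have hq1 : q < 1 := Real.exp_lt_one_iff.2 (by have := mul_pos hε hl; linarith)
  have hlim : Filter.Tendsto (fun n : ℕ => q ^ n * K) Filter.atTop (nhds 0) := by
    simpa using (tendsto_pow_atTop_nhds_zero_of_lt_one (Real.exp_pos _).le hq1).mul_const K
  have hlim2 : Filter.Tendsto (fun n : ℕ => 1 / (n : ℝ)) Filter.atTop (nhds 0) :=
    tendsto_one_div_atTop_nhds_zero_nat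
  filter_upwards [hlim.eventually (gt_mem_nhds (show 0 < ε / 6 by linarith)),
    hlim2.eventually (gt_mem_nhds (show 0 < ε / 6 by linarith)), Filter.eventually_gt_atTop 0]
    with n hn1 hn2 hn0
  have hn0 : (0 : ℝ) < n := Nat.cast_pos.2 hn0
  have hc0 : 0 ≤ c := by positivity
  obtain ⟨t, ht, ht'⟩ : ∃ t : ℕ, (c + 2 * ε / 3) * n ≤ t ∧ t ≤ (c + 2 * ε / 3) * n + 1 :=
    ⟨_, Nat.le_ceil _, (Nat.ceil_lt_add_one (by positivity)).le⟩
  have hE := EpSn_le hp0 hp1 hx1 (by rw [hsx]; exact hsy) hr0.le n t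
  have hdecay : rate p x ^ n * x⁻¹ ^ t ≤ q ^ n := by
    rw [← Real.exp_log hr0, ← Real.exp_log (inv_pos.2 hx0), ← Real.exp_nat_mul,
      ← Real.exp_nat_mul, ← Real.exp_add, hq, ← Real.exp_nat_mul, Real.exp_le_exp, Real.log_inv]
    have h1 : n * Real.log (rate p x) ≤ n * ((c + ε / 3) * Real.log x) :=
      mul_le_mul_of_nonneg_left (by rw [hlogx]; linarith) hn0.le
    have h2 := mul_le_mul_of_nonneg_right ht hl.le
    nlinarith
  rw [div_le_iff₀ hn0]
  have h1 : 1 ≤ ε / 6 * n := by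
    rw [div_lt_iff₀ hn0] at hn2
    exact hn2.le
  have h2 : n * rate p x ^ n * x⁻¹ ^ t * K ≤ ε / 6 * n := by
    calc n * rate p x ^ n * x⁻¹ ^ t * K = n * (rate p x ^ n * x⁻¹ ^ t * K) := by ring
      _ ≤ n * (q ^ n * K) := by gcongr
      _ ≤ n * (ε / 6) := by gcongr
      _ = _ := mul_comm _ _
  linarith

theorem thm0 (p : ℝ) (hp0 : 0 < p) (hp1 : p < 1) :
    Filter.limsup
      (fun n : ℕ => (((EpSn p n - ((1 + Real.sqrt (1 - p)) / p) * n) / n : ℝ) : EReal))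
      Filter.atTop ≤ (0 : EReal) := by
  refine EReal.le_of_forall_lt_iff_le.1 fun ε hε => ?_
  refine Filter.limsup_le_of_le (h := ?_)
  filter_upwards [eventually_EpSn_div_le hp0 hp1 (EReal.coe_pos.1 hε)] with n hn
  exact EReal.coe_le_coe_iff.2 hn
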